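/- Fix n ≥ 3 and consider n+2 sites {a, b, 1, …, n} (the crown graph). Define the real symmetric matrix M with rows and columns indexed by a symbol I together with all unordered pairs of distinct sites, by: M(I,I) = 1; M(I,h_{ab}) = M(h_{ab},h_{ab}) = 3(n−2)/(4(n−1)); M(I,h_{ai}) = M(h_{ai},h_{ai}) = M(I,h_{bi}) = M(h_{bi},h_{bi}) = 3n/(8(n−1)) for all i ∈ {1,…,n}; M(h_{ai},h_{aj}) = M(h_{bi},h_{bj}) = 3n/(16(n−1)) for i ≠ j; M(h_{ai},h_{bi}) = 3/(8(n−1)); M(h_{ai},h_{bj}) = 3(n+2)/(16(n−1)) for i ≠ j; M(h_{ai},h_{ab}) = M(h_{bi},h_{ab}) = 3(n−2)/(16(n−1)); and every entry in a row or column indexed by h_{ij} with i, j ∈ {1,…,n} equal to 0 (and entries determined by symmetry). Then M is positive semidefinite and is an NPA₁(Proj) moment matrix on the n+2 sites, and for every real weight x its objective on the crown graph with center-edge weight x equals x·M(I,h_{ab}) + Σ_{i=1}^n (M(I,h_{ai}) + M(I,h_{bi})) = (3n² + 3(n−2)x)/(4(n−1)). Moreover, for every x with (n+2)/3 < x < n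 this value is strictly greater than max(n+1, x + n/2). -/

import Mathlib

open Matrix Finset
open scoped ComplexOrder

noncomputable section

/-- Unordered pairs of distinct elements of `V`. -/
def PairIdx (V : Type*) := {e : Sym2 V // ¬ e.IsDiag}

instance {V : Type*} [DecidableEq V] [Fintype V] : Fintype (PairIdx V) :=
  Subtype.fintype _

instance {V : Type*} [DecidableEq V] : DecidableEq (PairIdx V) :=
  Subtype.instDecidableEq

/-- Index set for a level-1 projector moment matrix: the symbol `I` (`none`) together with
all unordered pairs of distinct sites. -/
abbrev MIdx (V : Type*) := Option (PairIdx V)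

/-- The unordered pair `{i, j}` for distinct `i ≠ j`. -/
def pr {V : Type*} (i j : V) (h : i ≠ j) : PairIdx V :=
  ⟨s(i, j), by simpa using h⟩

/-- A (complex) `NPA₁(Proj)` moment matrix on sites `V`. -/
def IsMomentMatrix {V : Type*} [Fintype V] [DecidableEq V]
    (M : Matrix (MIdx V) (MIdx V) ℂ) : Prop :=
  M.PosSemidef ∧
  M none none = 1 ∧
  (∀ e : PairIdx V, M (some e) (some e) = M none (some e)) ∧
  (∀ e f : PairIdx V, (∀ x : V, x ∈ e.1 → x ∉ f.1) →
      M (some e) (some f) = M (some f) (some e)) ∧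
  (∀ i j k : V, ∀ hij : i ≠ j, ∀ hjk : j ≠ k, ∀ hik : i ≠ k,
      M (some (pr i j hij)) (some (pr j k hjk)) +
        M (some (pr j k hjk)) (some (pr i j hij)) =
      (M none (some (pr i j hij)) + M none (some (pr j k hjk)) -
        M none (some (pr i k hik))) / 2)

/-- The sites of the crown graph: leaves `Sum.inl i` for `i ∈ {1,…,n}` and the two centers
`a = Sum.inr 0`, `b = Sum.inr 1`. -/
abbrev CrownSite (n : ℕ) := Fin n ⊕ Fin 2

/-- The value `M(I, h_e)` of the explicit crown moment matrix. -/
def crownRowVal (n : ℕ) (e : Sym2 (CrownSite n)) : ℝ :=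
  if (Sum.inr 0 : CrownSite n) ∈ e ∧ (Sum.inr 1 : CrownSite n) ∈ e then
    3 * ((n : ℝ) - 2) / (4 * ((n : ℝ) - 1))
  else if (Sum.inr 0 : CrownSite n) ∈ e ∨ (Sum.inr 1 : CrownSite n) ∈ e then
    3 * (n : ℝ) / (8 * ((n : ℝ) - 1))
  else 0

/-- The value `M(h_e, h_f)` of the explicit crown moment matrix. -/
def crownPairVal (n : ℕ) (e f : Sym2 (CrownSite n)) : ℝ :=
  if e = f then crownRowVal n e
  else if ((Sum.inr 0 : CrownSite n) ∉ e ∧ (Sum.inr 1 : CrownSite n) ∉ e) ∨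
          ((Sum.inr 0 : CrownSite n) ∉ f ∧ (Sum.inr 1 : CrownSite n) ∉ f) then 0
  else if e = s(Sum.inr 0, (Sum.inr 1 : CrownSite n)) ∨
          f = s(Sum.inr 0, (Sum.inr 1 : CrownSite n)) then
    3 * ((n : ℝ) - 2) / (16 * ((n : ℝ) - 1))
  else if ((Sum.inr 0 : CrownSite n) ∈ e ↔ (Sum.inr 0 : CrownSite n) ∈ f) then
    3 * (n : ℝ) / (16 * ((n : ℝ) - 1))
  else if ∃ i : Fin n, (Sum.inl i : CrownSite n) ∈ e ∧ (Sum.inl i : CrownSite n) ∈ f then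
    3 / (8 * ((n : ℝ) - 1))
  else 3 * ((n : ℝ) + 2) / (16 * ((n : ℝ) - 1))

/-- The explicit crown moment matrix. -/
def crownMM (n : ℕ) : Matrix (MIdx (CrownSite n)) (MIdx (CrownSite n)) ℂ :=
  Matrix.of fun r c =>
    match r, c with
    | none, none => 1
    | none, some e => ((crownRowVal n e.1 : ℝ) : ℂ)
    | some e, none => ((crownRowVal n e.1 : ℝ) : ℂ)
    | some e, some f => ((crownPairVal n e.1 f.1 : ℝ) : ℂ)

/-- A nonnegative multiple of a real rank-one matrix is positive semidefinite over `ℂ`. -/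
lemma posSemidef_ofReal_rankOne {ι : Type*} [Finite ι] (c : ℝ) (hc : 0 ≤ c) (w : ι → ℝ) :
    (Matrix.of fun r s => ((c * (w r * w s) : ℝ) : ℂ)).PosSemidef := by
  have h := (posSemidef_vecMulVec_self_star (fun r => (w r : ℂ))).smul
    (show (0 : ℂ) ≤ (c : ℂ) by exact_mod_cast hc)
  convert h using 1
  ext r s
  simp [vecMulVec_apply]

lemma sum_sum_sub_mul_sub {ι : Type*} [Fintype ι] (p q : ι → ℝ) :
    ∑ i, ∑ j, (p i - p j) * (q i - q j)
      = 2 * (Fintype.card ι * ∑ i, p i * q i - (∑ i, p i) * ∑ i, q i) := by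
  simp only [sub_mul, mul_sub, sum_sub_distrib, sum_const, card_univ, nsmul_eq_mul,
    ← mul_sum, ← sum_mul]
  ring

/-- The vector with value `u` at `I`, `v` at the center edge, `w` at the other edges of the
crown graph and `0` elsewhere. -/
def crownVec (n : ℕ) (u v w : ℝ) : MIdx (CrownSite n) → ℝ
  | none => u
  | some e =>
    if (Sum.inr 0 : CrownSite n) ∈ e.1 ∧ (Sum.inr 1 : CrownSite n) ∈ e.1 then v
    else if (Sum.inr 0 : CrownSite n) ∈ e.1 ∨ (Sum.inr 1 : CrownSite n) ∈ e.1 then w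
    else 0

/-- The difference of the basis vectors at the two crown edges at the leaf `i`. -/
def leafVec (n : ℕ) (i : Fin n) : MIdx (CrownSite n) → ℝ
  | none => 0
  | some e =>
    (if e.1 = s(Sum.inl i, (Sum.inr 0 : CrownSite n)) then 1 else 0)
      - (if e.1 = s(Sum.inl i, (Sum.inr 1 : CrownSite n)) then 1 else 0)

lemma pairIdx_crownSite_cases {n : ℕ} (e : PairIdx (CrownSite n)) :
    e.1 = s(Sum.inr 0, Sum.inr 1) ∨ (∃ i, e.1 = s(Sum.inl i, Sum.inr 0)) ∨
      (∃ i, e.1 = s(Sum.inl i, Sum.inr 1)) ∨ ∃ i j, e.1 = s(Sum.inl i, Sum.inl j) := by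
  obtain ⟨e, he⟩ := e
  induction e using Sym2.ind with
  | _ x y =>
    rcases x with i | i <;> rcases y with j | j
    · exact Or.inr (Or.inr (Or.inr ⟨i, j, rfl⟩))
    · fin_cases j <;> simp
    · fin_cases i <;> simp
    · fin_cases i <;> fin_cases j <;> simp at he ⊢

lemma crownMM_eq_rankOne_sum (n : ℕ) (hn : 3 ≤ n) (r s : MIdx (CrownSite n)) :
    crownMM n r s =
      (((3 * ((n : ℝ) - 2) / (4 * ((n : ℝ) - 1)))
            * (crownVec n 1 1 (1 / 4) r * crownVec n 1 1 (1 / 4) s)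
        + (((n : ℝ) + 2) / (4 * ((n : ℝ) - 1)))
            * (crownVec n 1 0 (3 / 4) r * crownVec n 1 0 (3 / 4) s)
        + ∑ i, ∑ j, 3 / (32 * ((n : ℝ) - 1))
            * ((leafVec n i r - leafVec n j r) * (leafVec n i s - leafVec n j s)) : ℝ) : ℂ) := by
  have h1 : (n : ℝ) - 1 ≠ 0 := by
    have : (3 : ℝ) ≤ n := by exact_mod_cast hn
    linarith
  simp only [← mul_sum]
  rw [sum_sum_sub_mul_sub (fun i => leafVec n i r) (fun i => leafVec n i s), Fintype.card_fin]
  rcases r with _ | e <;> rcases s with _ | f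
  · simp only [crownMM, of_apply, crownVec, leafVec]
    rw [← Complex.ofReal_one, Complex.ofReal_inj]
    simp
    field_simp
    ring
  · simp only [crownMM, of_apply, crownVec, leafVec, crownRowVal]
    rw [Complex.ofReal_inj]
    rcases pairIdx_crownSite_cases f with h | ⟨i, h⟩ | ⟨i, h⟩ | ⟨i, j, h⟩ <;>
      simp [h] <;> field_simp <;> ring
  · simp only [crownMM, of_apply, crownVec, leafVec, crownRowVal]
    rw [Complex.ofReal_inj]
    rcases pairIdx_crownSite_cases e with h | ⟨i, h⟩ | ⟨i, h⟩ | ⟨i, j, h⟩ <;>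
      simp [h] <;> field_simp <;> ring
  · simp only [crownMM, of_apply, crownVec, leafVec, crownPairVal, crownRowVal]
    rw [Complex.ofReal_inj]
    rcases pairIdx_crownSite_cases e with h | ⟨i, h⟩ | ⟨i, h⟩ | ⟨i, j, h⟩ <;>
      rcases pairIdx_crownSite_cases f with h' | ⟨k, h'⟩ | ⟨k, h'⟩ | ⟨k, l, h'⟩ <;>
      (try by_cases hik : i = k) <;>
      simp [*] <;> field_simp <;> ring

lemma crownMM_posSemidef (n : ℕ) (hn : 3 ≤ n) : (crownMM n).PosSemidef := by
  have h3 : (3 : ℝ) ≤ n := by exact_mod_cast hn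
  have h1 : 0 < (n : ℝ) - 1 := by linarith
  have hA := posSemidef_ofReal_rankOne (3 * ((n : ℝ) - 2) / (4 * ((n : ℝ) - 1)))
    (div_nonneg (by linarith) (by linarith)) (crownVec n 1 1 (1 / 4))
  have hB := posSemidef_ofReal_rankOne (((n : ℝ) + 2) / (4 * ((n : ℝ) - 1)))
    (div_nonneg (by linarith) (by linarith)) (crownVec n 1 0 (3 / 4))
  have hC := posSemidef_sum univ fun i _ => posSemidef_sum univ fun j _ =>
    posSemidef_ofReal_rankOne (3 / (32 * ((n : ℝ) - 1))) (div_nonneg (by norm_num) (by linarith))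
      (fun r => leafVec n i r - leafVec n j r)
  convert (hA.add hB).add hC using 1
  ext r s
  rw [crownMM_eq_rankOne_sum n hn r s]
  simp [Matrix.sum_apply]

lemma crownMM_isMomentMatrix (n : ℕ) (hn : 3 ≤ n) : IsMomentMatrix (crownMM n) := by
  have h1 : (n : ℝ) - 1 ≠ 0 := by
    have : (3 : ℝ) ≤ n := by exact_mod_cast hn
    linarith
  refine ⟨crownMM_posSemidef n hn, rfl, ?_, ?_, ?_⟩
  · intro e
    simp [crownMM, crownPairVal]
  · intro e f _
    rw [crownMM_eq_rankOne_sum n hn, crownMM_eq_rankOne_sum n hn]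
    simp only [mul_comm]
  · intro i j k hij hjk hik
    simp only [crownMM, of_apply, pr]
    norm_cast
    have hki := hik.symm
    rcases i with i | i <;> rcases j with j | j <;> rcases k with k | k <;>
      (try fin_cases i) <;> (try fin_cases j) <;> (try fin_cases k) <;>
      simp_all [crownPairVal, crownRowVal] <;> field_simp <;> ring

/-- The explicit crown matrix is a feasible `NPA₁(Proj)` moment matrix whose objective on
the crown graph with center-edge weight `x` equals `(3n² + 3(n−2)x)/(4(n−1))`, which for
`(n+2)/3 < x < n` strictly exceeds the true maximum eigenvalue `max(n+1, x + n/2)`. -/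
theorem stmt19 (n : ℕ) (hn : 3 ≤ n) :
    (crownMM n).PosSemidef ∧
    IsMomentMatrix (crownMM n) ∧
    (∀ x : ℝ,
      x * ((crownMM n) none (some (pr (Sum.inr 0 : CrownSite n) (Sum.inr 1) (by simp)))).re
        + ∑ i : Fin n,
            (((crownMM n) none (some (pr (Sum.inl i : CrownSite n) (Sum.inr 0) (by simp)))).re
              + ((crownMM n) none (some (pr (Sum.inl i : CrownSite n) (Sum.inr 1) (by simp)))).re)
      = (3 * (n : ℝ) ^ 2 + 3 * ((n : ℝ) - 2) * x) / (4 * ((n : ℝ) - 1))) ∧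
    (∀ x : ℝ, ((n : ℝ) + 2) / 3 < x → x < (n : ℝ) →
      max ((n : ℝ) + 1) (x + (n : ℝ) / 2)
        < (3 * (n : ℝ) ^ 2 + 3 * ((n : ℝ) - 2) * x) / (4 * ((n : ℝ) - 1))) := by
  have h3 : (3 : ℝ) ≤ n := by exact_mod_cast hn
  have h1 : 0 < (n : ℝ) - 1 := by linarith
  refine ⟨crownMM_posSemidef n hn, crownMM_isMomentMatrix n hn, ?_, ?_⟩
  · intro x
    simp only [crownMM, of_apply, Complex.ofReal_re]
    simp [crownRowVal, pr]
    field_simp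
    ring
  · intro x hx hxn
    rw [max_lt_iff, lt_div_iff₀ (by linarith), lt_div_iff₀ (by linarith)]
    constructor
    · nlinarith [mul_pos (show (0 : ℝ) < n - 2 by linarith) (show 0 < x - (n + 2) / 3 by linarith)]
    · nlinarith [mul_pos (show (0 : ℝ) < n + 2 by linarith) (sub_pos.2 hxn)]

end
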